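/- Let n ≥ 1, s ∈ (0,1), 1 ≤ p < ∞ with sp > n, let Ω ⊂ ℝⁿ be a bounded open set, and let 0 < μ < μ_s^* = s − n/p. Then for every sequence (u_k) of functions in C_c^∞(ℝⁿ) such that sup_k ( ‖u_k‖_{L^p(ℝⁿ)} + ‖D^s u_k‖_{L^p(ℝⁿ;ℝⁿ)} ) < ∞, there exists a subsequence (u_{k_j}) whose restrictions to the closure Ω̄ converge in the Hölder norm ‖·‖_{C^{0,μ}(Ω̄)}. (Compactness of the embedding H^{s,p}(ℝⁿ) ↪ C^{0,μ}(Ω̄) in the supercritical case, where H^{s,p}(ℝⁿ) is the closure of C_c^∞(ℝⁿ) in the norm ‖u‖_{L^p} + ‖D^s u‖_{L^p}.) -/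

import Mathlib

open MeasureTheory Filter ENNReal

noncomputable section

/-- The normalization constant `c_{n,s}` of the Riesz fractional gradient. -/
def cns (n : ℕ) (s : ℝ) : ℝ :=
  ((n : ℝ) + s - 1) * Real.Gamma (((n : ℝ) + s - 1) / 2) /
    (Real.pi ^ ((n : ℝ) / 2) * (2 : ℝ) ^ (1 - s) * Real.Gamma ((1 - s) / 2))

/-- The Riesz fractional gradient
`D^s u (x) = c_{n,s} ∫ (u(x) - u(y))/|x-y|^{n+s} ⬝ (x-y)/|x-y| dy`. -/
def rieszGrad (n : ℕ) (s : ℝ) (u : EuclideanSpace ℝ (Fin n) → ℝ)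
    (x : EuclideanSpace ℝ (Fin n)) : EuclideanSpace ℝ (Fin n) :=
  cns n s • ∫ y, ((u x - u y) / ‖x - y‖ ^ ((n : ℝ) + s + 1)) • (x - y)

/-- The Hölder norm `‖f‖_{C^{0,μ}(K)} = sup_{x ∈ K} |f x| +
sup_{x ≠ y ∈ K} |f x - f y| / |x - y|^μ`, valued in `ℝ≥0∞`. -/
def holderNorm (n : ℕ) (μ : ℝ) (K : Set (EuclideanSpace ℝ (Fin n)))
    (f : EuclideanSpace ℝ (Fin n) → ℝ) : ℝ≥0∞ :=
  (⨆ x ∈ K, ENNReal.ofReal |f x|) +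
    ⨆ x ∈ K, ⨆ y ∈ K, ⨆ _ : x ≠ y, ENNReal.ofReal (|f x - f y| / ‖x - y‖ ^ μ)

lemma aux_gauss_pt {t r : ℝ} (ht : 0 < t) :
    r * Real.exp (-t * r ^ 2) ≤ t ^ (-(1 / 2) : ℝ) * Real.exp (-(t / 2) * r ^ 2) := by
  have h1 : Real.exp (-t * r ^ 2) = Real.exp (-(t / 2) * r ^ 2) * Real.exp (-(t / 2) * r ^ 2) := by
    rw [← Real.exp_add]; ring_nf
  rw [h1, ← mul_assoc]
  refine mul_le_mul_of_nonneg_right ?_ (Real.exp_pos _).le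
  have h2 : (t ^ (-(1 / 2) : ℝ)) = (Real.sqrt t)⁻¹ := by
    rw [Real.rpow_neg ht.le, Real.sqrt_eq_rpow]
  have hst := Real.sqrt_pos.2 ht
  rw [h2, neg_mul, Real.exp_neg, ← div_eq_mul_inv, div_le_iff₀ (Real.exp_pos _),
    ← div_eq_inv_mul, le_div_iff₀ hst]
  have h3 := Real.add_one_le_exp (t / 2 * r ^ 2)
  have h4 := Real.sq_sqrt ht.le
  nlinarith [sq_nonneg (r * Real.sqrt t - 1)]

lemma aux_gauss_int (n : ℕ) {b : ℝ} (hb : 0 < b) :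
    Integrable (fun v : EuclideanSpace ℝ (Fin n) => Real.exp (-b * ‖v‖ ^ 2)) := by
  have h := (GaussianFourier.integrable_cexp_neg_mul_sq_norm_add (b := (b : ℂ))
    (V := EuclideanSpace ℝ (Fin n)) (by simpa using hb) 0 0).norm
  refine h.congr (ae_of_all _ fun v => ?_)
  simp only [Complex.norm_exp]
  congr 1
  have : (-(b : ℂ) * (‖v‖ : ℂ) ^ 2 + 0 * ((inner ℝ (0 : EuclideanSpace ℝ (Fin n)) v : ℝ) : ℂ)) =
    ((-b * ‖v‖ ^ 2 : ℝ) : ℂ) := by push_cast; ring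
  rw [this, Complex.ofReal_re]

lemma aux_gauss_int1 (n : ℕ) {b : ℝ} (hb : 0 < b) :
    Integrable (fun v : EuclideanSpace ℝ (Fin n) => ‖v‖ * Real.exp (-b * ‖v‖ ^ 2)) := by
  refine ((aux_gauss_int n (half_pos hb)).const_mul (b ^ (-(1 / 2) : ℝ))).mono'
    (by fun_prop) (ae_of_all _ fun v => ?_)
  rw [Real.norm_of_nonneg (by positivity)]
  exact aux_gauss_pt hb

lemma aux_gauss_moment (n : ℕ) {t : ℝ} (ht : 0 < t) (ξ e : EuclideanSpace ℝ (Fin n)) :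
    ∫ z : EuclideanSpace ℝ (Fin n), Complex.exp (((-2 * Real.pi * inner ℝ z ξ : ℝ) : ℂ) * Complex.I) *
      ((inner ℝ e z * Real.exp (-t * ‖z‖ ^ 2) : ℝ) : ℂ) =
    -Complex.I * ((Real.pi / t * inner ℝ e ξ * (Real.pi / t) ^ ((n : ℝ) / 2) *
      Real.exp (-(Real.pi ^ 2 * ‖ξ‖ ^ 2 / t)) : ℝ) : ℂ) := by
  set f : EuclideanSpace ℝ (Fin n) → ℂ := fun v => Complex.exp (-(t : ℂ) * (‖v‖ : ℂ) ^ 2) with hf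
  have hfr : ∀ v, f v = ((Real.exp (-t * ‖v‖ ^ 2) : ℝ) : ℂ) := fun v => by
    simp [hf]
  have hfn : ∀ v, ‖f v‖ = Real.exp (-t * ‖v‖ ^ 2) := fun v => by
    rw [hfr, Complex.norm_real, Real.norm_of_nonneg (Real.exp_pos _).le]
  have hfc : Continuous f := by fun_prop
  have hi : Integrable f := by
    refine (aux_gauss_int n ht).mono' hfc.aestronglyMeasurable (ae_of_all _ fun v => (hfn v).le)
  have hi1 : Integrable (fun v => ‖v‖ * ‖f v‖) := by
    simp_rw [hfn]; exact aux_gauss_int1 n ht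
  have hG : FourierTransform.fourier f = fun w : EuclideanSpace ℝ (Fin n) =>
      (((Real.pi / t) ^ ((n : ℝ) / 2) * Real.exp (-(Real.pi ^ 2 * ‖w‖ ^ 2 / t)) : ℝ) : ℂ) := by
    funext w
    rw [hf, fourier_gaussian_innerProductSpace (by simpa using ht)]
    rw [finrank_euclideanSpace_fin]
    have : (0:ℝ) ≤ Real.pi / t := by positivity
    push_cast [Complex.ofReal_cpow this]
    congr 2
    ring
  have hd := Real.hasFDerivAt_fourier hi hi1 ξ
  rw [hG] at hd
  have hd2 : HasFDerivAt (fun w : EuclideanSpace ℝ (Fin n) =>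
      (Real.pi / t) ^ ((n : ℝ) / 2) * Real.exp (-(Real.pi ^ 2 * ‖w‖ ^ 2 / t)))
      (((Real.pi / t) ^ ((n : ℝ) / 2)) • (Real.exp (-(Real.pi ^ 2 * ‖ξ‖ ^ 2 / t)) •
        (-(Real.pi ^ 2 / t)) • (2 : ℝ) • (innerSL ℝ ξ))) ξ := by
    have h1 : HasFDerivAt (fun w : EuclideanSpace ℝ (Fin n) => ‖w‖ ^ 2) ((2 : ℝ) • (innerSL ℝ ξ)) ξ := by
      have := (hasStrictFDerivAt_norm_sq ξ).hasFDerivAt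
      simpa [two_smul] using this
    have h2 := (h1.const_mul (-(Real.pi ^ 2 / t))).exp.const_mul ((Real.pi / t) ^ ((n : ℝ) / 2))
    convert! h2 using 3 <;> ring_nf
  have hd3 := Complex.ofRealCLM.hasFDerivAt.comp ξ hd2
  have he := congrArg (fun A => A e) (hd.unique hd3)
  beta_reduce at he
  have hsm : Integrable (VectorFourier.fourierSMulRight (innerSL ℝ) f) := by
    refine Integrable.mono' (hi1.const_mul (2 * Real.pi * ‖(innerSL ℝ : EuclideanSpace ℝ (Fin n) →L[ℝ] _)‖)) ?_ (ae_of_all _ fun v => ?_)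
    · exact hfc.aestronglyMeasurable.fourierSMulRight
    · refine (VectorFourier.norm_fourierSMulRight_le _ _ _).trans (by rw [mul_assoc])
  rw [Real.fourier_eq', ContinuousLinearMap.integral_apply] at he
  · have key : ∀ z : EuclideanSpace ℝ (Fin n), (Complex.exp (((-2 * Real.pi * inner ℝ z ξ : ℝ) : ℂ) * Complex.I) •
        VectorFourier.fourierSMulRight (innerSL ℝ) f z) e = (-(2 * Real.pi * Complex.I)) *
        (Complex.exp (((-2 * Real.pi * inner ℝ z ξ : ℝ) : ℂ) * Complex.I) *
      ((inner ℝ e z * Real.exp (-t * ‖z‖ ^ 2) : ℝ) : ℂ)) := by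
      intro z
      rw [smul_apply, VectorFourier.fourierSMulRight_apply, hfr]
      change _ • (-(2 * Real.pi * Complex.I) • ((inner ℝ z e : ℝ) • _)) = _
      simp only [smul_eq_mul, Complex.real_smul, real_inner_comm z e]
      push_cast
      ring
    simp_rw [key] at he
    rw [integral_const_mul] at he
    have h2 : (-(2 * Real.pi * Complex.I)) ≠ 0 := by
      simp [Real.pi_ne_zero, Complex.I_ne_zero]
    apply mul_left_cancel₀ h2
    rw [he]
    simp only [ContinuousLinearMap.comp_apply, smul_apply, innerSL_apply_apply,
      Complex.ofRealCLM_apply, smul_eq_mul, real_inner_comm ξ e]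
    have hI : (-(2 * (Real.pi : ℂ) * Complex.I)) * -Complex.I = ((-(2 * Real.pi) : ℝ) : ℂ) := by
      push_cast; ring_nf; simp
    rw [← mul_assoc (-(2 * (Real.pi : ℂ) * Complex.I)), hI]
    norm_cast
    ring
  · rw [← integrable_norm_iff (by
      refine AEStronglyMeasurable.smul (f := fun v : EuclideanSpace ℝ (Fin n) => Complex.exp (((-2 * Real.pi * inner ℝ v ξ : ℝ) : ℂ) * Complex.I)) ?_ hsm.aestronglyMeasurable
      exact Continuous.aestronglyMeasurable (by fun_prop))]
    refine hsm.norm.congr (ae_of_all _ fun v => ?_)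
    simp only [norm_smul, Complex.norm_exp_ofReal_mul_I, one_mul]

lemma aux_gamma_inv {q A : ℝ} (hq : 0 < q) (hA : 0 < A) :
    IntegrableOn (fun t : ℝ => t ^ (-q - 1) * Real.exp (-(A / t))) (Set.Ioi 0) ∧
    ∫ t in Set.Ioi (0 : ℝ), t ^ (-q - 1) * Real.exp (-(A / t)) = A ^ (-q) * Real.Gamma q := by
  have hrw : ∀ t ∈ Set.Ioi (0 : ℝ), t ^ (-q - 1) * Real.exp (-(A / t)) =
      (|(-1 : ℝ)| * t ^ ((-1 : ℝ) - 1)) • ((t ^ (-1 : ℝ)) ^ (q - 1) * Real.exp (-(A * t ^ (-1 : ℝ)))) := by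
    intro t ht
    have ht : 0 < t := ht
    rw [← Real.rpow_mul ht.le, smul_eq_mul, abs_neg, abs_one, one_mul, ← mul_assoc, ← Real.rpow_add ht,
      Real.rpow_neg_one, div_eq_mul_inv]
    ring_nf
  have hg : IntegrableOn (fun t : ℝ => t ^ (q - 1) * Real.exp (-(A * t))) (Set.Ioi 0) := by
    have := integrableOn_rpow_mul_exp_neg_mul_rpow (s := q - 1) (p := 1) (b := A) (by linarith) (by norm_num) hA
    simpa using this
  constructor
  · rw [integrableOn_congr_fun hrw measurableSet_Ioi]
    rw [integrableOn_Ioi_comp_rpow_iff (fun y => y ^ (q - 1) * Real.exp (-(A * y))) (by norm_num : (-1 : ℝ) ≠ 0)]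
    exact hg
  · rw [setIntegral_congr_fun measurableSet_Ioi hrw,
      integral_comp_rpow_Ioi (fun y => y ^ (q - 1) * Real.exp (-(A * y))) (by norm_num : (-1 : ℝ) ≠ 0),
      Real.integral_rpow_mul_exp_neg_mul_Ioi hq hA, one_div, Real.inv_rpow hA.le, Real.rpow_neg hA.le]

lemma aux_gamma_int {q A : ℝ} (hq : 0 < q) (hA : 0 < A) :
    IntegrableOn (fun t : ℝ => t ^ (q - 1) * Real.exp (-(A * t))) (Set.Ioi 0) ∧
    ∫ t in Set.Ioi (0 : ℝ), t ^ (q - 1) * Real.exp (-(A * t)) = A ^ (-q) * Real.Gamma q := by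
  constructor
  · have := integrableOn_rpow_mul_exp_neg_mul_rpow (s := q - 1) (p := 1) (b := A) (by linarith) (by norm_num) hA
    simpa using this
  · rw [Real.integral_rpow_mul_exp_neg_mul_Ioi hq hA, one_div, Real.inv_rpow hA.le, Real.rpow_neg hA.le]

lemma aux_kernel_int (n : ℕ) (hn : 1 ≤ n) {s : ℝ} (hs0 : 0 < s) (hs1 : s < 1) :
    Integrable (fun z : EuclideanSpace ℝ (Fin n) => min 1 ‖z‖ * ‖z‖ ^ (-((n : ℝ) + s))) := by
  have : Nonempty (Fin n) := ⟨⟨0, hn⟩⟩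
  have : Nontrivial (EuclideanSpace ℝ (Fin n)) := inferInstance
  rw [integrable_fun_norm_addHaar (volume : Measure (EuclideanSpace ℝ (Fin n)))
    (f := fun r => min 1 r * r ^ (-((n : ℝ) + s)))]
  rw [finrank_euclideanSpace_fin]
  have hrw : ∀ r ∈ Set.Ioi (0:ℝ), r ^ (n - 1) • (min 1 r * r ^ (-((n : ℝ) + s))) = min 1 r * r ^ (-1 - s) := by
    intro r hr
    have hr : 0 < r := hr
    rw [smul_eq_mul, ← Real.rpow_natCast, mul_left_comm, ← Real.rpow_add hr]
    congr 2
    push_cast [Nat.cast_sub hn]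
    ring
  rw [integrableOn_congr_fun hrw measurableSet_Ioi, ← Set.Ioc_union_Ioi_eq_Ioi zero_le_one]
  refine IntegrableOn.union ?_ ?_
  · have h : IntegrableOn (fun r : ℝ => r ^ (-s)) (Set.Ioc 0 1) := by
      have := intervalIntegral.intervalIntegrable_rpow' (a := 0) (b := 1) (r := -s) (by linarith)
      exact (intervalIntegrable_iff_integrableOn_Ioc_of_le zero_le_one).1 this
    refine h.congr_fun (fun r hr => ?_) measurableSet_Ioc
    simp only
    rw [min_eq_right hr.2]
    nth_rw 2 [← Real.rpow_one r]
    rw [← Real.rpow_add hr.1]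
    ring_nf
  · refine (integrableOn_Ioi_rpow_of_lt (a := -1 - s) (by linarith) zero_lt_one).congr_fun
      (fun r hr => ?_) measurableSet_Ioi
    simp only
    rw [min_eq_left (le_of_lt hr), one_mul]


lemma aux_exp_bound (n : ℕ) (z ξ : EuclideanSpace ℝ (Fin n)) :
    ‖(1 : ℂ) - Complex.exp (((-2 * Real.pi * inner ℝ z ξ : ℝ) : ℂ) * Complex.I)‖ ≤
      2 * Real.pi * (1 + ‖ξ‖) * min 1 ‖z‖ := by
  have hpi := Real.pi_gt_three
  rcases le_total 1 ‖z‖ with h | h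
  · rw [min_eq_left h]
    refine (norm_sub_le _ _).trans ?_
    rw [Complex.norm_exp_ofReal_mul_I, norm_one]
    nlinarith [norm_nonneg ξ]
  · rw [min_eq_right h, norm_sub_rev, mul_comm _ Complex.I]
    refine Real.norm_exp_I_mul_ofReal_sub_one_le.trans ?_
    rw [norm_mul, norm_mul, Real.norm_of_nonneg Real.pi_pos.le, norm_neg, Real.norm_of_nonneg zero_le_two]
    have h1 := norm_inner_le_norm (𝕜 := ℝ) z ξ
    have h2 : ‖z‖ * ‖ξ‖ ≤ (1 + ‖ξ‖) * ‖z‖ := by nlinarith [norm_nonneg z]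
    calc 2 * Real.pi * ‖inner ℝ z ξ‖ ≤ 2 * Real.pi * ((1 + ‖ξ‖) * ‖z‖) := by gcongr; exact h1.trans h2
      _ = _ := by ring

/-- constant in the symbol of the fractional gradient -/
def cJ (n : ℕ) (s : ℝ) : ℝ :=
  Real.pi * Real.pi ^ ((n : ℝ) / 2) * (Real.pi ^ 2) ^ (-((1 - s) / 2)) * Real.Gamma ((1 - s) / 2) /
    Real.Gamma (((n : ℝ) + s + 1) / 2)

lemma cJ_pos (n : ℕ) {s : ℝ} (hs0 : 0 < s) (hs1 : s < 1) : 0 < cJ n s := by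
  have h1 := Real.Gamma_pos_of_pos (show 0 < (1 - s) / 2 by linarith)
  have h2 := Real.Gamma_pos_of_pos (show 0 < ((n : ℝ) + s + 1) / 2 by positivity)
  unfold cJ
  have := Real.pi_pos
  positivity

lemma aux_J (n : ℕ) (hn : 1 ≤ n) {s : ℝ} (hs0 : 0 < s) (hs1 : s < 1)
    (ξ e : EuclideanSpace ℝ (Fin n)) :
    ∫ z : EuclideanSpace ℝ (Fin n), (1 - Complex.exp (((-2 * Real.pi * inner ℝ z ξ : ℝ) : ℂ) * Complex.I)) *
      ((inner ℝ e z * ‖z‖ ^ (-((n : ℝ) + s + 1)) : ℝ) : ℂ) =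
    Complex.I * ((cJ n s * (inner ℝ e ξ * ‖ξ‖ ^ (s - 1)) : ℝ) : ℂ) := by
  rcases eq_or_ne ξ 0 with rfl | hξ
  · simp
  set a : ℝ := ((n : ℝ) + s + 1) / 2 with ha
  have ha0 : 0 < a := by positivity
  have hG := Real.Gamma_pos_of_pos ha0
  set H : EuclideanSpace ℝ (Fin n) → ℝ → ℂ := fun z t =>
    (1 - Complex.exp (((-2 * Real.pi * inner ℝ z ξ : ℝ) : ℂ) * Complex.I)) *
      ((inner ℝ e z * (t ^ (a - 1) * Real.exp (-(‖z‖ ^ 2 * t))) : ℝ) : ℂ) with hH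
  have hpow : ∀ z : EuclideanSpace ℝ (Fin n), (‖z‖ ^ 2) ^ (-a) = ‖z‖ ^ (-((n : ℝ) + s + 1)) := by
    intro z
    rw [← Real.rpow_natCast, ← Real.rpow_mul (norm_nonneg _)]
    congr 1
    rw [ha]; push_cast; ring
  have hHint : ∀ z : EuclideanSpace ℝ (Fin n), ∫ t in Set.Ioi (0:ℝ), H z t = Real.Gamma a *
      ((1 - Complex.exp (((-2 * Real.pi * inner ℝ z ξ : ℝ) : ℂ) * Complex.I)) *
      ((inner ℝ e z * ‖z‖ ^ (-((n : ℝ) + s + 1)) : ℝ) : ℂ)) := by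
    intro z
    rcases eq_or_ne z 0 with rfl | hz
    · simp [hH]
    have hz2 : 0 < ‖z‖ ^ 2 := by positivity
    simp only [hH]
    rw [integral_const_mul, integral_complex_ofReal, integral_const_mul, (aux_gamma_int ha0 hz2).2, hpow]
    push_cast
    ring
  have hHn : ∀ z : EuclideanSpace ℝ (Fin n), ∫ t in Set.Ioi (0:ℝ), ‖H z t‖ = Real.Gamma a *
      (‖1 - Complex.exp (((-2 * Real.pi * inner ℝ z ξ : ℝ) : ℂ) * Complex.I)‖ *
      (|inner ℝ e z| * ‖z‖ ^ (-((n : ℝ) + s + 1)))) := by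
    intro z
    rcases eq_or_ne z 0 with rfl | hz
    · simp [hH]
    have hz2 : 0 < ‖z‖ ^ 2 := by positivity
    have : ∀ t ∈ Set.Ioi (0:ℝ), ‖H z t‖ = ‖1 - Complex.exp (((-2 * Real.pi * inner ℝ z ξ : ℝ) : ℂ) * Complex.I)‖ * (|inner ℝ e z| *
        (t ^ (a - 1) * Real.exp (-(‖z‖ ^ 2 * t)))) := by
      intro t ht
      have ht : 0 < t := ht
      simp only [hH]
      rw [norm_mul, Complex.norm_real, norm_mul, Real.norm_eq_abs, Real.norm_of_nonneg (r := t ^ (a - 1) * Real.exp (-(‖z‖ ^ 2 * t))) (by positivity)]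
    rw [setIntegral_congr_fun measurableSet_Ioi this, integral_const_mul, integral_const_mul,
      (aux_gamma_int ha0 hz2).2, hpow]
    ring
  have hmeas : AEStronglyMeasurable (Function.uncurry H) (volume.prod (volume.restrict (Set.Ioi (0:ℝ)))) := by
    apply Measurable.aestronglyMeasurable
    simp only [hH, Function.uncurry_def]
    fun_prop
  have hprod : Integrable (Function.uncurry H) (volume.prod (volume.restrict (Set.Ioi (0:ℝ)))) := by
    rw [integrable_prod_iff hmeas]
    constructor
    · refine ae_of_all _ fun z => ?_
      simp only [Function.uncurry]
      rcases eq_or_ne z 0 with rfl | hz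
      · simp [hH]
      have hz2 : 0 < ‖z‖ ^ 2 := by positivity
      simp only [hH]
      exact (((aux_gamma_int ha0 hz2).1.const_mul (inner ℝ e z)).ofReal).const_mul _
    · simp only [Function.uncurry]
      refine ((aux_kernel_int n hn hs0 hs1).const_mul (Real.Gamma a * (2 * Real.pi * (1 + ‖ξ‖) * ‖e‖))).mono'
        ?_ (ae_of_all _ fun z => ?_)
      · simp_rw [hHn]
        apply Measurable.aestronglyMeasurable
        fun_prop
      · rw [hHn, Real.norm_of_nonneg (by positivity), mul_assoc (Real.Gamma a)]
        refine mul_le_mul_of_nonneg_left ?_ hG.le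
        have h1 := aux_exp_bound n z ξ
        have h2 : |inner ℝ e z| * ‖z‖ ^ (-((n : ℝ) + s + 1)) ≤ ‖e‖ * ‖z‖ ^ (-((n : ℝ) + s)) := by
          rcases eq_or_ne z 0 with rfl | hz
          · simp only [inner_zero_right, abs_zero, zero_mul]; positivity
          have hz0 : 0 < ‖z‖ := by positivity
          calc |inner ℝ e z| * ‖z‖ ^ (-((n : ℝ) + s + 1)) ≤ (‖e‖ * ‖z‖) * ‖z‖ ^ (-((n : ℝ) + s + 1)) := by
                gcongr; exact abs_real_inner_le_norm e z
            _ = ‖e‖ * (‖z‖ ^ (1:ℝ) * ‖z‖ ^ (-((n : ℝ) + s + 1))) := by rw [Real.rpow_one]; ring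
            _ = _ := by rw [← Real.rpow_add hz0]; ring_nf
        calc _ ≤ (2 * Real.pi * (1 + ‖ξ‖) * min 1 ‖z‖) * (‖e‖ * ‖z‖ ^ (-((n : ℝ) + s))) := by gcongr
          _ = _ := by ring
  have hswap := integral_integral_swap hprod
  simp_rw [hHint] at hswap
  rw [integral_const_mul] at hswap
  have hin : ∀ t ∈ Set.Ioi (0:ℝ), ∫ z, H z t = Complex.I * ((Real.pi * Real.pi ^ ((n : ℝ) / 2) * inner ℝ e ξ *
      (t ^ (-((1 - s) / 2) - 1) * Real.exp (-(Real.pi ^ 2 * ‖ξ‖ ^ 2 / t))) : ℝ) : ℂ) := by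
    intro t ht
    have ht : 0 < t := ht
    have hi1 : Integrable (fun z : EuclideanSpace ℝ (Fin n) => (inner ℝ e z * Real.exp (-t * ‖z‖ ^ 2) : ℝ)) := by
      refine ((aux_gauss_int1 n ht).const_mul ‖e‖).mono' (by fun_prop) (ae_of_all _ fun z => ?_)
      rw [norm_mul, Real.norm_of_nonneg (Real.exp_pos _).le, ← mul_assoc]
      gcongr; exact norm_inner_le_norm e z
    have hi2 : Integrable (fun z : EuclideanSpace ℝ (Fin n) => Complex.exp (((-2 * Real.pi * inner ℝ z ξ : ℝ) : ℂ) * Complex.I) *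
        ((inner ℝ e z * Real.exp (-t * ‖z‖ ^ 2) : ℝ) : ℂ)) := by
      refine hi1.norm.mono' (by fun_prop) (ae_of_all _ fun z => ?_)
      rw [norm_mul, Complex.norm_exp_ofReal_mul_I, one_mul, Complex.norm_real]
    have hi1c : Integrable (fun z : EuclideanSpace ℝ (Fin n) => ((inner ℝ e z * Real.exp (-t * ‖z‖ ^ 2) : ℝ) : ℂ)) := hi1.ofReal
    have h0 : ∫ z : EuclideanSpace ℝ (Fin n), ((inner ℝ e z * Real.exp (-t * ‖z‖ ^ 2) : ℝ) : ℂ) = 0 := by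
      have := aux_gauss_moment n ht 0 e
      simpa only [inner_zero_right, mul_zero, zero_mul, Complex.ofReal_zero, Complex.exp_zero, one_mul] using this
    have h1 := aux_gauss_moment n ht ξ e
    have heq : ∀ z, H z t = ((t ^ (a - 1) : ℝ) : ℂ) * (((inner ℝ e z * Real.exp (-t * ‖z‖ ^ 2) : ℝ) : ℂ) -
        Complex.exp (((-2 * Real.pi * inner ℝ z ξ : ℝ) : ℂ) * Complex.I) *
        ((inner ℝ e z * Real.exp (-t * ‖z‖ ^ 2) : ℝ) : ℂ)) := by
      intro z
      simp only [hH]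
      rw [show -(‖z‖ ^ 2 * t) = -t * ‖z‖ ^ 2 by ring]
      push_cast; ring
    simp_rw [heq]
    rw [integral_const_mul, integral_sub hi1c hi2]
    rw [h0, h1, zero_sub, neg_mul, neg_neg, mul_left_comm, ← Complex.ofReal_mul]
    congr 2
    rw [Real.div_rpow Real.pi_pos.le ht.le]
    have : t ^ (-((1 - s) / 2) - 1) = t ^ (a - 1) * (t ^ ((n : ℝ) / 2))⁻¹ * t⁻¹ := by
      rw [← Real.rpow_neg ht.le, ← Real.rpow_neg_one t, ← Real.rpow_add ht, ← Real.rpow_add ht]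
      congr 1; rw [ha]; ring
    rw [this]
    ring
  rw [setIntegral_congr_fun measurableSet_Ioi hin, integral_const_mul, integral_complex_ofReal, integral_const_mul,
    (aux_gamma_inv (show 0 < (1 - s) / 2 by linarith) (show 0 < Real.pi ^ 2 * ‖ξ‖ ^ 2 by positivity)).2] at hswap
  have hG' : (Real.Gamma a : ℂ) ≠ 0 := by exact_mod_cast hG.ne'
  apply mul_left_cancel₀ hG'
  rw [hswap, mul_left_comm _ Complex.I, ← Complex.ofReal_mul]
  congr 2
  have h3 : (Real.pi ^ 2 * ‖ξ‖ ^ 2) ^ (-((1 - s) / 2)) = (Real.pi ^ 2) ^ (-((1 - s) / 2)) * ‖ξ‖ ^ (s - 1) := by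
    rw [Real.mul_rpow (by positivity) (by positivity), ← Real.rpow_natCast ‖ξ‖, ← Real.rpow_mul (norm_nonneg ξ)]
    congr 2; push_cast; ring
  rw [h3, cJ, ← ha]
  field_simp


/-- A continuous function represented as the inverse Fourier transform of a rapidly decaying one. -/
structure GoodPair (n : ℕ) (u : EuclideanSpace ℝ (Fin n) → ℝ) (V : EuclideanSpace ℝ (Fin n) → ℂ) : Prop where
  cont : Continuous u
  contV : Continuous V
  int : ∀ k : ℕ, Integrable (fun ξ => ‖ξ‖ ^ k * ‖V ξ‖)
  inv : ∀ x, (u x : ℂ) = ∫ ξ, Complex.exp (((2 * Real.pi * inner ℝ ξ x : ℝ) : ℂ) * Complex.I) * V ξ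

lemma GoodPair.intV {n : ℕ} {u : EuclideanSpace ℝ (Fin n) → ℝ} {V : EuclideanSpace ℝ (Fin n) → ℂ}
    (h : GoodPair n u V) : Integrable V := by
  have := h.int 0
  simp only [pow_zero, one_mul] at this
  exact (integrable_norm_iff h.contV.aestronglyMeasurable).1 this

lemma GoodPair.int1 {n : ℕ} {u : EuclideanSpace ℝ (Fin n) → ℝ} {V : EuclideanSpace ℝ (Fin n) → ℂ}
    (h : GoodPair n u V) : Integrable (fun ξ => (1 + ‖ξ‖) * ‖V ξ‖) := by
  refine ((h.int 0).add (h.int 1)).congr (ae_of_all _ fun ξ => ?_)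
  simp only [Pi.add_apply]
  ring

lemma GoodPair.intE {n : ℕ} {u : EuclideanSpace ℝ (Fin n) → ℝ} {V : EuclideanSpace ℝ (Fin n) → ℂ}
    (h : GoodPair n u V) (x : EuclideanSpace ℝ (Fin n)) :
    Integrable (fun ξ => Complex.exp (((2 * Real.pi * inner ℝ ξ x : ℝ) : ℂ) * Complex.I) * V ξ) := by
  have hc := h.contV
  refine h.intV.norm.mono' (by fun_prop) (ae_of_all _ fun ξ => ?_)
  rw [norm_mul, Complex.norm_exp_ofReal_mul_I, one_mul]

lemma GoodPair.diff {n : ℕ} {u : EuclideanSpace ℝ (Fin n) → ℝ} {V : EuclideanSpace ℝ (Fin n) → ℂ}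
    (h : GoodPair n u V) (x z : EuclideanSpace ℝ (Fin n)) :
    ((u x - u (x - z) : ℝ) : ℂ) =
      ∫ ξ, Complex.exp (((2 * Real.pi * inner ℝ ξ x : ℝ) : ℂ) * Complex.I) * V ξ *
        (1 - Complex.exp (((-2 * Real.pi * inner ℝ z ξ : ℝ) : ℂ) * Complex.I)) := by
  rw [Complex.ofReal_sub, h.inv, h.inv, ← integral_sub (h.intE x) (h.intE (x - z))]
  congr 1
  funext ξ
  have : Complex.exp (((2 * Real.pi * inner ℝ ξ (x - z) : ℝ) : ℂ) * Complex.I) =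
      Complex.exp (((2 * Real.pi * inner ℝ ξ x : ℝ) : ℂ) * Complex.I) *
      Complex.exp (((-2 * Real.pi * inner ℝ z ξ : ℝ) : ℂ) * Complex.I) := by
    rw [← Complex.exp_add, inner_sub_right, real_inner_comm ξ z]
    congr 1
    push_cast; ring
  rw [this]; ring

lemma GoodPair.diff_bound {n : ℕ} {u : EuclideanSpace ℝ (Fin n) → ℝ} {V : EuclideanSpace ℝ (Fin n) → ℂ}
    (h : GoodPair n u V) (x z : EuclideanSpace ℝ (Fin n)) :
    |u x - u (x - z)| ≤ (2 * Real.pi * ∫ ξ, (1 + ‖ξ‖) * ‖V ξ‖) * min 1 ‖z‖ := by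
  have h1 : |u x - u (x - z)| = ‖((u x - u (x - z) : ℝ) : ℂ)‖ := by rw [Complex.norm_real]; rfl
  rw [h1, h.diff x z]
  have h2 := h.int1.const_mul (2 * Real.pi * min 1 ‖z‖)
  refine (norm_integral_le_of_norm_le h2 (ae_of_all _ fun ξ => ?_)).trans (le_of_eq ?_)
  · rw [norm_mul, norm_mul, Complex.norm_exp_ofReal_mul_I, one_mul]
    calc _ ≤ ‖V ξ‖ * (2 * Real.pi * (1 + ‖ξ‖) * min 1 ‖z‖) := by
          gcongr; exact aux_exp_bound n z ξ
      _ = _ := by ring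
  · rw [integral_const_mul]; ring

lemma aux_ker_norm {n : ℕ} {s : ℝ} (z : EuclideanSpace ℝ (Fin n)) :
    ‖z‖ * ‖z‖ ^ (-((n : ℝ) + s + 1)) ≤ ‖z‖ ^ (-((n : ℝ) + s)) := by
  rcases eq_or_ne z 0 with rfl | hz
  · rw [norm_zero, zero_mul]; positivity
  have hz0 : 0 < ‖z‖ := by positivity
  refine le_of_eq ?_
  nth_rw 1 [← Real.rpow_one ‖z‖]
  rw [← Real.rpow_add hz0]; ring_nf

lemma aux_rieszGrad_sub {n : ℕ} {s : ℝ} (u : EuclideanSpace ℝ (Fin n) → ℝ) (x : EuclideanSpace ℝ (Fin n)) :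
    rieszGrad n s u x = cns n s • ∫ z, ((u x - u (x - z)) * ‖z‖ ^ (-((n : ℝ) + s + 1))) • z := by
  unfold rieszGrad
  congr 1
  rw [← integral_sub_left_eq_self _ volume x]
  congr 1
  funext z
  rw [Real.rpow_neg (norm_nonneg _), ← div_eq_mul_inv]
  simp

lemma GoodPair.grad {n : ℕ} (hn : 1 ≤ n) {s : ℝ} (hs0 : 0 < s) (hs1 : s < 1)
    {u : EuclideanSpace ℝ (Fin n) → ℝ} {V : EuclideanSpace ℝ (Fin n) → ℂ}
    (h : GoodPair n u V) (x e : EuclideanSpace ℝ (Fin n)) :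
    ((inner ℝ e (rieszGrad n s u x) : ℝ) : ℂ) = ((cns n s * cJ n s : ℝ) : ℂ) * (Complex.I *
      ∫ ξ, Complex.exp (((2 * Real.pi * inner ℝ ξ x : ℝ) : ℂ) * Complex.I) * V ξ *
        ((inner ℝ e ξ * ‖ξ‖ ^ (s - 1) : ℝ) : ℂ)) := by
  have hc := h.cont
  have hcV := h.contV
  have hK := aux_kernel_int n hn hs0 hs1
  have hIntg : Integrable (fun z => ((u x - u (x - z)) * ‖z‖ ^ (-((n : ℝ) + s + 1))) • z) := by
    refine (hK.const_mul (2 * Real.pi * ∫ ξ, (1 + ‖ξ‖) * ‖V ξ‖)).mono' ?_ (ae_of_all _ fun z => ?_)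
    · apply Measurable.aestronglyMeasurable
      fun_prop
    · rw [norm_smul, norm_mul, Real.norm_eq_abs, Real.norm_of_nonneg (r := ‖z‖ ^ (-((n : ℝ) + s + 1))) (by positivity)]
      calc _ = |u x - u (x - z)| * (‖z‖ * ‖z‖ ^ (-((n : ℝ) + s + 1))) := by ring
        _ ≤ ((2 * Real.pi * ∫ ξ, (1 + ‖ξ‖) * ‖V ξ‖) * min 1 ‖z‖) * ‖z‖ ^ (-((n : ℝ) + s)) :=
          mul_le_mul (h.diff_bound x z) (aux_ker_norm z) (by positivity)
            ((abs_nonneg _).trans (h.diff_bound x z))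
        _ = _ := by ring
  rw [aux_rieszGrad_sub, inner_smul_right, ← integral_inner hIntg]
  rw [Complex.ofReal_mul, Complex.ofReal_mul, mul_assoc]
  congr 1
  rw [← integral_complex_ofReal]
  set H : EuclideanSpace ℝ (Fin n) → EuclideanSpace ℝ (Fin n) → ℂ := fun z ξ =>
    Complex.exp (((2 * Real.pi * inner ℝ ξ x : ℝ) : ℂ) * Complex.I) * V ξ *
        ((1 - Complex.exp (((-2 * Real.pi * inner ℝ z ξ : ℝ) : ℂ) * Complex.I)) *
        ((inner ℝ e z * ‖z‖ ^ (-((n : ℝ) + s + 1)) : ℝ) : ℂ)) with hH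
  have h1 : ∀ z, ((inner ℝ e (((u x - u (x - z)) * ‖z‖ ^ (-((n : ℝ) + s + 1))) • z) : ℝ) : ℂ) =
      ∫ ξ, H z ξ := by
    intro z
    simp only [hH, ← mul_assoc]
    rw [integral_mul_const, ← h.diff, inner_smul_right, ← Complex.ofReal_mul]
    congr 1
    ring
  simp_rw [h1]
  have hprod : Integrable (Function.uncurry H) (volume.prod volume) := by
    have hd := (hK.const_mul (2 * Real.pi * ‖e‖)).mul_prod h.int1
    refine hd.mono' ?_ (ae_of_all _ fun ⟨z, ξ⟩ => ?_)
    · apply Measurable.aestronglyMeasurable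
      simp only [hH, Function.uncurry_def]
      fun_prop
    · simp only [Function.uncurry, hH]
      rw [norm_mul, norm_mul, Complex.norm_exp_ofReal_mul_I, one_mul, norm_mul, Complex.norm_real, norm_mul,
        Real.norm_of_nonneg (r := ‖z‖ ^ (-((n : ℝ) + s + 1))) (by positivity)]
      have h3 := aux_ker_norm (s := s) z
      calc _ ≤ ‖V ξ‖ * ((2 * Real.pi * (1 + ‖ξ‖) * min 1 ‖z‖) * ((‖e‖ * ‖z‖) * ‖z‖ ^ (-((n : ℝ) + s + 1)))) := by
            gcongr
            · exact aux_exp_bound n z ξ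
            · exact norm_inner_le_norm e z
        _ = ‖V ξ‖ * ((2 * Real.pi * (1 + ‖ξ‖) * min 1 ‖z‖) * (‖e‖ * (‖z‖ * ‖z‖ ^ (-((n : ℝ) + s + 1))))) := by ring
        _ ≤ ‖V ξ‖ * ((2 * Real.pi * (1 + ‖ξ‖) * min 1 ‖z‖) * (‖e‖ * ‖z‖ ^ (-((n : ℝ) + s)))) := by gcongr
        _ = _ := by ring
  rw [integral_integral_swap hprod]
  simp only [hH]
  simp_rw [integral_const_mul, aux_J n hn hs0 hs1]
  rw [← integral_const_mul, ← integral_const_mul]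
  congr 1
  funext ξ
  push_cast
  ring

/-- Gaussian vector kernel. -/
def WK {n : ℕ} (t : ℝ) (z : EuclideanSpace ℝ (Fin n)) : EuclideanSpace ℝ (Fin n) :=
  Real.exp (-t * ‖z‖ ^ 2) • z

lemma aux_rpow_le {r s : ℝ} (hr : 0 ≤ r) (hs0 : 0 < s) (hs1 : s < 1) : r * r ^ (s - 1) ≤ 1 + r := by
  rcases hr.eq_or_lt with rfl | hr
  · simp
  have : r * r ^ (s - 1) = r ^ s := by
    nth_rw 1 [← Real.rpow_one r]
    rw [← Real.rpow_add hr]; ring_nf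
  rw [this]
  rcases le_total r 1 with h | h
  · have := Real.rpow_le_one hr.le h hs0.le
    linarith
  · have := Real.rpow_le_rpow_of_exponent_le h hs1.le
    rw [Real.rpow_one] at this
    linarith

lemma GoodPair.gaussConv {n : ℕ} (hn : 1 ≤ n) {s : ℝ} (hs0 : 0 < s) (hs1 : s < 1)
    {u : EuclideanSpace ℝ (Fin n) → ℝ} {V : EuclideanSpace ℝ (Fin n) → ℂ}
    (h : GoodPair n u V) (x : EuclideanSpace ℝ (Fin n)) {t : ℝ} (ht : 0 < t) :
    ((∫ y, inner ℝ (WK t (x - y)) (rieszGrad n s u y) : ℝ) : ℂ) =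
      ((cns n s * cJ n s * (Real.pi * Real.pi ^ ((n : ℝ) / 2)) : ℝ) : ℂ) *
      ∫ ξ, Complex.exp (((2 * Real.pi * inner ℝ ξ x : ℝ) : ℂ) * Complex.I) * V ξ *
        ((‖ξ‖ ^ (1 + s) * (t ^ (-1 - (n : ℝ) / 2) * Real.exp (-(Real.pi ^ 2 * ‖ξ‖ ^ 2 / t))) : ℝ) : ℂ) := by
  have hc := h.cont
  have hcV := h.contV
  rw [← integral_sub_left_eq_self (fun y => inner ℝ (WK t (x - y)) (rieszGrad n s u y)) volume x, ← integral_complex_ofReal]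
  simp only [_root_.sub_sub_cancel, h.grad hn hs0 hs1]
  rw [integral_const_mul, integral_const_mul]
  set H : EuclideanSpace ℝ (Fin n) → EuclideanSpace ℝ (Fin n) → ℂ := fun z ξ =>
    Complex.exp (((2 * Real.pi * inner ℝ ξ x : ℝ) : ℂ) * Complex.I) * V ξ * ((‖ξ‖ ^ (s - 1) : ℝ) : ℂ) *
      (Complex.exp (((-2 * Real.pi * inner ℝ z ξ : ℝ) : ℂ) * Complex.I) *
      ((inner ℝ ξ z * Real.exp (-t * ‖z‖ ^ 2) : ℝ) : ℂ)) with hH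
  have h1 : ∀ z ξ, Complex.exp (((2 * Real.pi * inner ℝ ξ (x - z) : ℝ) : ℂ) * Complex.I) * V ξ *
        ((inner ℝ (WK t z) ξ * ‖ξ‖ ^ (s - 1) : ℝ) : ℂ) = H z ξ := by
    intro z ξ
    have : Complex.exp (((2 * Real.pi * inner ℝ ξ (x - z) : ℝ) : ℂ) * Complex.I) =
      Complex.exp (((2 * Real.pi * inner ℝ ξ x : ℝ) : ℂ) * Complex.I) *
      Complex.exp (((-2 * Real.pi * inner ℝ z ξ : ℝ) : ℂ) * Complex.I) := by
      rw [← Complex.exp_add, inner_sub_right, real_inner_comm ξ z]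
      congr 1
      push_cast; ring
    simp only [hH]
    rw [this, WK, real_inner_smul_left, real_inner_comm ξ z]
    push_cast
    ring
  simp_rw [h1]
  have hprod : Integrable (Function.uncurry H) (volume.prod volume) := by
    have hd := (aux_gauss_int1 n ht).mul_prod h.int1
    refine hd.mono' ?_ (ae_of_all _ fun ⟨z, ξ⟩ => ?_)
    · apply Measurable.aestronglyMeasurable
      simp only [hH, Function.uncurry_def]
      fun_prop
    · simp only [Function.uncurry, hH]
      rw [norm_mul, norm_mul, norm_mul, norm_mul, Complex.norm_exp_ofReal_mul_I, Complex.norm_exp_ofReal_mul_I,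
        one_mul, one_mul, Complex.norm_real, Complex.norm_real, norm_mul,
        Real.norm_of_nonneg (r := Real.exp (-t * ‖z‖ ^ 2)) (by positivity),
        Real.norm_of_nonneg (r := ‖ξ‖ ^ (s - 1)) (by positivity)]
      have h3 := aux_rpow_le (norm_nonneg ξ) hs0 hs1
      calc _ ≤ ‖V ξ‖ * ‖ξ‖ ^ (s - 1) * (‖ξ‖ * ‖z‖ * Real.exp (-t * ‖z‖ ^ 2)) := by
            gcongr
            exact norm_inner_le_norm ξ z
        _ = (‖ξ‖ * ‖ξ‖ ^ (s - 1)) * ‖V ξ‖ * (‖z‖ * Real.exp (-t * ‖z‖ ^ 2)) := by ring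
        _ ≤ (1 + ‖ξ‖) * ‖V ξ‖ * (‖z‖ * Real.exp (-t * ‖z‖ ^ 2)) := by gcongr
        _ = _ := by ring
  rw [integral_integral_swap hprod]
  simp only [hH]
  simp_rw [integral_const_mul, aux_gauss_moment n ht]
  rw [Complex.ofReal_mul (cns n s * cJ n s), mul_assoc]
  congr 1
  rw [← integral_const_mul, ← integral_const_mul]
  congr 1
  funext ξ
  have h4 : ‖ξ‖ ^ (1 + s) = ‖ξ‖ ^ (s - 1) * inner ℝ ξ ξ := by
    rw [real_inner_self_eq_norm_sq]
    rcases eq_or_ne ξ 0 with rfl | hξ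
    · rw [norm_zero, Real.zero_rpow (by positivity)]; simp
    · rw [← Real.rpow_natCast, ← Real.rpow_add (by positivity)]
      congr 1; push_cast; ring
  have h5 : t ^ (-1 - (n : ℝ) / 2) = t⁻¹ * (t ^ ((n : ℝ) / 2))⁻¹ := by
    rw [← Real.rpow_neg ht.le, ← Real.rpow_neg_one, ← Real.rpow_add ht]
    rfl
  rw [h4, h5, Real.div_rpow Real.pi_pos.le ht.le, div_eq_mul_inv Real.pi t, div_eq_mul_inv (Real.pi ^ ((n : ℝ) / 2))]
  set X := Complex.exp (((2 * Real.pi * inner ℝ ξ x : ℝ) : ℂ) * Complex.I)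
  set Y := Real.exp (-(Real.pi ^ 2 * ‖ξ‖ ^ 2 / t))
  simp only [Complex.ofReal_mul]
  linear_combination (-X * V ξ * ((‖ξ‖ ^ (s - 1) : ℝ) : ℂ) * (((Real.pi : ℝ) : ℂ) * ((t⁻¹ : ℝ) : ℂ) * ((inner ℝ ξ ξ : ℝ) : ℂ) *
    (((Real.pi ^ ((n : ℝ) / 2) : ℝ) : ℂ) * (((t ^ ((n : ℝ) / 2))⁻¹ : ℝ) : ℂ)) * (Y : ℂ))) * Complex.I_sq


lemma cns_pos (n : ℕ) (hn : 1 ≤ n) {s : ℝ} (hs0 : 0 < s) (hs1 : s < 1) : 0 < cns n s := by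
  have hn' : (1 : ℝ) ≤ n := by exact_mod_cast hn
  have h0 : 0 < (n : ℝ) + s - 1 := by linarith
  have h1 := Real.Gamma_pos_of_pos (show 0 < (1 - s) / 2 by linarith)
  have h2 := Real.Gamma_pos_of_pos (show 0 < ((n : ℝ) + s - 1) / 2 by linarith)
  unfold cns
  have := Real.pi_pos
  positivity

/-- constant in the representation formula -/
def cR (n : ℕ) (s : ℝ) : ℝ :=
  cns n s * cJ n s * (Real.pi * Real.pi ^ ((n : ℝ) / 2)) *
    ((Real.pi ^ 2) ^ (-((1 + s) / 2)) * Real.Gamma ((1 + s) / 2))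

lemma cR_pos (n : ℕ) (hn : 1 ≤ n) {s : ℝ} (hs0 : 0 < s) (hs1 : s < 1) : 0 < cR n s := by
  have h1 := Real.Gamma_pos_of_pos (show 0 < (1 + s) / 2 by linarith)
  have h2 := cns_pos n hn hs0 hs1
  have h3 := cJ_pos n hs0 hs1
  have := Real.pi_pos
  unfold cR
  positivity

lemma GoodPair.repr {n : ℕ} (hn : 1 ≤ n) {s : ℝ} (hs0 : 0 < s) (hs1 : s < 1)
    {u : EuclideanSpace ℝ (Fin n) → ℝ} {V : EuclideanSpace ℝ (Fin n) → ℂ}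
    (h : GoodPair n u V) (x : EuclideanSpace ℝ (Fin n)) :
    IntegrableOn (fun t : ℝ => t ^ (((n : ℝ) - s - 1) / 2) *
      ∫ y, inner ℝ (WK t (x - y)) (rieszGrad n s u y)) (Set.Ioi 0) ∧
    ∫ t in Set.Ioi (0 : ℝ), t ^ (((n : ℝ) - s - 1) / 2) *
      ∫ y, inner ℝ (WK t (x - y)) (rieszGrad n s u y) = cR n s * u x := by
  have hcV := h.contV
  have : Nonempty (Fin n) := ⟨⟨0, hn⟩⟩
  have : Nontrivial (EuclideanSpace ℝ (Fin n)) := inferInstance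
  set q : ℝ := (1 + s) / 2 with hq
  have hq0 : 0 < q := by positivity
  set c2 : ℝ := cns n s * cJ n s * (Real.pi * Real.pi ^ ((n : ℝ) / 2)) with hc2
  set H : EuclideanSpace ℝ (Fin n) → ℝ → ℂ := fun ξ t =>
    (c2 : ℂ) * (Complex.exp (((2 * Real.pi * inner ℝ ξ x : ℝ) : ℂ) * Complex.I) * V ξ) *
      ((‖ξ‖ ^ (1 + s) * (t ^ (-q - 1) * Real.exp (-(Real.pi ^ 2 * ‖ξ‖ ^ 2 / t))) : ℝ) : ℂ) with hH
  have hpow : ∀ ξ : EuclideanSpace ℝ (Fin n), ξ ≠ 0 → ‖ξ‖ ^ (1 + s) * ((Real.pi ^ 2 * ‖ξ‖ ^ 2) ^ (-q) * Real.Gamma q) =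
      (Real.pi ^ 2) ^ (-q) * Real.Gamma q := by
    intro ξ hξ
    have h0 : 0 < ‖ξ‖ := by positivity
    rw [Real.mul_rpow (by positivity) (by positivity), ← Real.rpow_natCast ‖ξ‖, ← Real.rpow_mul h0.le]
    have : ‖ξ‖ ^ (1 + s) * ‖ξ‖ ^ (((2 : ℕ) : ℝ) * -q) = 1 := by
      rw [← Real.rpow_add h0, hq]
      have : 1 + s + ((2 : ℕ) : ℝ) * -((1 + s) / 2) = 0 := by push_cast; ring
      rw [this, Real.rpow_zero]
    linear_combination ((Real.pi ^ 2) ^ (-q) * Real.Gamma q) * this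
  have hpi : ∀ ξ : EuclideanSpace ℝ (Fin n), ξ ≠ 0 → 0 < Real.pi ^ 2 * ‖ξ‖ ^ 2 := by
    intro ξ hξ
    have := Real.pi_pos
    positivity
  have hne : ∀ᵐ ξ : EuclideanSpace ℝ (Fin n), ξ ≠ 0 := by
    rw [ae_iff]; simp
  have hHt : ∀ t ∈ Set.Ioi (0 : ℝ), ((t ^ (((n : ℝ) - s - 1) / 2) *
      ∫ y, inner ℝ (WK t (x - y)) (rieszGrad n s u y) : ℝ) : ℂ) = ∫ ξ, H ξ t := by
    intro t ht
    have ht : 0 < t := ht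
    rw [Complex.ofReal_mul, h.gaussConv hn hs0 hs1 x ht, ← mul_assoc, ← integral_const_mul]
    congr 1
    funext ξ
    simp only [hH]
    have : t ^ (-q - 1) = t ^ (((n : ℝ) - s - 1) / 2) * t ^ (-1 - (n : ℝ) / 2) := by
      rw [← Real.rpow_add ht]; congr 1; rw [hq]; ring
    rw [this, hc2]
    push_cast
    ring
  have hHξ : ∀ ξ, ξ ≠ 0 → ∫ t in Set.Ioi (0 : ℝ), H ξ t =
      (cR n s : ℂ) * (Complex.exp (((2 * Real.pi * inner ℝ ξ x : ℝ) : ℂ) * Complex.I) * V ξ) := by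
    intro ξ hξ
    simp only [hH]
    rw [integral_const_mul, integral_complex_ofReal, integral_const_mul, (aux_gamma_inv hq0 (hpi ξ hξ)).2,
      hpow ξ hξ, cR, ← hc2, ← hq]
    push_cast
    ring
  have hmeas : AEStronglyMeasurable (Function.uncurry H) (volume.prod (volume.restrict (Set.Ioi (0:ℝ)))) := by
    apply Measurable.aestronglyMeasurable
    simp only [hH, Function.uncurry_def]
    fun_prop
  have hprod : Integrable (Function.uncurry H) (volume.prod (volume.restrict (Set.Ioi (0:ℝ)))) := by
    rw [integrable_prod_iff hmeas]
    constructor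
    · filter_upwards [hne] with ξ hξ
      simp only [Function.uncurry, hH]
      exact (((aux_gamma_inv hq0 (hpi ξ hξ)).1.const_mul (‖ξ‖ ^ (1 + s))).ofReal).const_mul _
    · simp only [Function.uncurry]
      refine (h.intV.norm.const_mul (|c2| * ((Real.pi ^ 2) ^ (-q) * Real.Gamma q))).congr ?_
      filter_upwards [hne] with ξ hξ
      have : ∀ t ∈ Set.Ioi (0:ℝ), ‖H ξ t‖ = |c2| * ‖V ξ‖ * (‖ξ‖ ^ (1 + s) * (t ^ (-q - 1) * Real.exp (-(Real.pi ^ 2 * ‖ξ‖ ^ 2 / t)))) := by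
        intro t ht
        have ht : 0 < t := ht
        simp only [hH]
        rw [norm_mul, norm_mul, norm_mul, Complex.norm_exp_ofReal_mul_I, one_mul, Complex.norm_real, Complex.norm_real,
          Real.norm_eq_abs c2, Real.norm_of_nonneg (by positivity)]
      rw [setIntegral_congr_fun measurableSet_Ioi this, integral_const_mul, integral_const_mul,
        (aux_gamma_inv hq0 (hpi ξ hξ)).2, hpow ξ hξ]
      ring
  constructor
  · have h1 := hprod.integral_prod_right
    simp only [Function.uncurry] at h1
    have h2 : IntegrableOn (fun t : ℝ => ((t ^ (((n : ℝ) - s - 1) / 2) *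
      ∫ y, inner ℝ (WK t (x - y)) (rieszGrad n s u y) : ℝ) : ℂ)) (Set.Ioi 0) := by
      rw [integrableOn_congr_fun hHt measurableSet_Ioi]
      exact h1
    have h3 := Integrable.re h2
    simp only [RCLike.ofReal_re, Complex.ofReal_re, RCLike.re_to_complex] at h3
    exact h3
  · apply Complex.ofReal_injective
    rw [← integral_complex_ofReal, setIntegral_congr_fun measurableSet_Ioi hHt, ← integral_integral_swap hprod]
    rw [integral_congr_ae (hne.mono hHξ), integral_const_mul, ← h.inv, Complex.ofReal_mul]

lemma aux_goodPair {n : ℕ} {u : EuclideanSpace ℝ (Fin n) → ℝ} (hu : ContDiff ℝ (⊤ : ℕ∞) u)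
    (hs : HasCompactSupport u) : ∃ V, GoodPair n u V := by
  have h1 : HasCompactSupport (fun x => (u x : ℂ)) := hs.comp_left (g := fun r : ℝ => (r : ℂ)) (by simp)
  have h2 : ContDiff ℝ (⊤ : ℕ∞) (fun x => (u x : ℂ)) := Complex.ofRealCLM.contDiff.comp hu
  let f := h1.toSchwartzMap h2
  refine ⟨FourierTransform.fourier f, hu.continuous, (FourierTransform.fourier f).continuous, fun k => ?_, fun x => ?_⟩
  · exact SchwartzMap.integrable_pow_mul volume (FourierTransform.fourier f) k
  · have h3 : (FourierTransformInv.fourierInv (FourierTransform.fourier f)) x = f x := by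
      rw [FourierTransform.fourierInv_fourier_eq]
    rw [SchwartzMap.fourierInv_coe, Real.fourierInv_eq'] at h3
    exact h3.symm

lemma aux_grad_meas {n : ℕ} {s : ℝ} {u : EuclideanSpace ℝ (Fin n) → ℝ} (hu : Continuous u) :
    StronglyMeasurable (rieszGrad n s u) := by
  have h : StronglyMeasurable (fun x : EuclideanSpace ℝ (Fin n) =>
      ∫ y, ((u x - u y) / ‖x - y‖ ^ ((n : ℝ) + s + 1)) • (x - y)) := by
   refine StronglyMeasurable.integral_prod_right' (f := fun p : EuclideanSpace ℝ (Fin n) × EuclideanSpace ℝ (Fin n) =>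
    ((u p.1 - u p.2) / ‖p.1 - p.2‖ ^ ((n : ℝ) + s + 1)) • (p.1 - p.2)) ?_
   apply Measurable.stronglyMeasurable
   fun_prop
  exact h.const_smul (cns n s)

lemma aux_conv_bound {n : ℕ} {p q : ℝ} (hpq : p.HolderConjugate q)
    {g κ : EuclideanSpace ℝ (Fin n) → EuclideanSpace ℝ (Fin n)} (hg : MemLp g (ENNReal.ofReal p))
    (hκc : Continuous κ) {A β : ℝ} (hβ : 0 < β) (x : EuclideanSpace ℝ (Fin n))
    (hκ : ∀ y, ‖κ y‖ ≤ A * Real.exp (-β * ‖x - y‖ ^ 2)) :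
    Integrable (fun y => inner ℝ (κ y) (g y)) ∧
    |∫ y, inner ℝ (κ y) (g y)| ≤
      A * ((eLpNorm g (ENNReal.ofReal p) volume).toReal * (Real.pi / (β * q)) ^ ((n : ℝ) / 2 * (1 / q))) := by
  have hp0 : 0 < p := hpq.pos
  have hq0 : 0 < q := hpq.symm.pos
  have hA : 0 ≤ A := by
    have := (norm_nonneg _).trans (hκ x)
    simpa using this
  set G : EuclideanSpace ℝ (Fin n) → ℝ := fun y => Real.exp (-β * ‖x - y‖ ^ 2) with hG
  have hGc : Continuous G := by fun_prop
  have hGq : ∀ y, G y ^ q = Real.exp (-(β * q) * ‖x - y‖ ^ 2) := by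
    intro y
    simp only [hG]
    rw [← Real.exp_mul]; ring_nf
  have hGqi : Integrable (fun y => G y ^ q) := by
    simp_rw [hGq]
    exact (aux_gauss_int n (show 0 < β * q by positivity)).comp_sub_left x
  have hGm : MemLp G (ENNReal.ofReal q) := by
    rw [← integrable_norm_rpow_iff hGc.aestronglyMeasurable (by simpa using hq0) ENNReal.ofReal_ne_top,
      ENNReal.toReal_ofReal hq0.le]
    refine hGqi.congr (ae_of_all _ fun y => ?_)
    simp only [hG, Real.norm_of_nonneg (Real.exp_pos _).le]
  have hprodi : Integrable (fun y => ‖g y‖ * G y) := by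
    haveI : ENNReal.HolderTriple (ENNReal.ofReal p) (ENNReal.ofReal q) 1 := by
      constructor
      rw [← ENNReal.ofReal_inv_of_pos hp0, ← ENNReal.ofReal_inv_of_pos hq0, ← ENNReal.ofReal_add (by positivity) (by positivity),
        hpq.inv_add_inv_eq_one]
      simp
    exact hg.norm.integrable_mul hGm
  have hpt : ∀ y, ‖(inner ℝ (κ y) (g y) : ℝ)‖ ≤ A * (‖g y‖ * G y) := by
    intro y
    refine (norm_inner_le_norm _ _).trans ?_
    calc _ ≤ (A * G y) * ‖g y‖ := by gcongr; exact hκ y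
      _ = _ := by ring
  refine ⟨(hprodi.const_mul A).mono' ?_ (ae_of_all _ hpt), ?_⟩
  · exact hκc.aestronglyMeasurable.inner hg.1
  · rw [← Real.norm_eq_abs]
    refine (norm_integral_le_of_norm_le (hprodi.const_mul A) (ae_of_all _ hpt)).trans ?_
    rw [integral_const_mul]
    refine mul_le_mul_of_nonneg_left ?_ hA
    refine (integral_mul_le_Lp_mul_Lq_of_nonneg hpq (ae_of_all _ fun y => norm_nonneg (g y)) (ae_of_all _ fun y => (Real.exp_pos _).le)
      hg.norm hGm).trans (le_of_eq ?_)
    congr 1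
    · rw [hg.eLpNorm_eq_integral_rpow_norm (by simpa using hp0) ENNReal.ofReal_ne_top, ENNReal.toReal_ofReal hp0.le,
        ENNReal.toReal_ofReal (by positivity), one_div]
    · rw [show (∫ a, G a ^ q) = ∫ y, Real.exp (-(β * q) * ‖x - y‖ ^ 2) from
        integral_congr_ae (ae_of_all _ hGq)]
      rw [integral_sub_left_eq_self (fun y : EuclideanSpace ℝ (Fin n) => Real.exp (-(β * q) * ‖y‖ ^ 2)) volume x,
        GaussianFourier.integral_rexp_neg_mul_sq_norm (by positivity), finrank_euclideanSpace_fin,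
        ← Real.rpow_mul (by have := Real.pi_pos; positivity)]

lemma aux_WK_bound {n : ℕ} {t : ℝ} (ht : 0 < t) (z : EuclideanSpace ℝ (Fin n)) :
    ‖WK t z‖ ≤ t ^ (-(1 / 2) : ℝ) * Real.exp (-(t / 4) * ‖z‖ ^ 2) := by
  rw [WK, norm_smul, Real.norm_of_nonneg (Real.exp_pos _).le, mul_comm]
  refine (aux_gauss_pt ht).trans ?_
  gcongr
  linarith

lemma aux_exp_sub {a b : ℝ} : |Real.exp (-a) - Real.exp (-b)| ≤ |a - b| * (Real.exp (-a) + Real.exp (-b)) := by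
  wlog hab : a ≤ b generalizing a b
  · have := this (le_of_not_ge hab)
    rw [abs_sub_comm, abs_sub_comm a b, add_comm]; exact this
  have h1 : Real.exp (-b) ≤ Real.exp (-a) := Real.exp_le_exp.2 (by linarith)
  rw [abs_of_nonneg (by linarith), abs_of_nonpos (by linarith)]
  have h2 : Real.exp (-b) = Real.exp (-a) * Real.exp (-(b - a)) := by rw [← Real.exp_add]; ring_nf
  have h3 := Real.add_one_le_exp (-(b - a))
  nlinarith [Real.exp_pos (-a), Real.exp_pos (-b)]

lemma aux_WK_diff {n : ℕ} {t : ℝ} (ht : 0 < t) (z h : EuclideanSpace ℝ (Fin n)) (hh : t * ‖h‖ ^ 2 ≤ 1) :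
    ‖WK t z - WK t (z - h)‖ ≤ (65 * ‖h‖) * Real.exp (-(t / 4) * ‖z‖ ^ 2) := by
  set r := ‖z‖
  set r' := ‖z - h‖
  set η := ‖h‖
  have hr : 0 ≤ r := norm_nonneg _
  have hr' : 0 ≤ r' := norm_nonneg _
  have hη : 0 ≤ η := norm_nonneg _
  have h1 : r' ≤ r + η := norm_sub_le _ _
  have h2 : r ≤ r' + η := by
    have := norm_add_le (z - h) h
    rwa [sub_add_cancel] at this
  have hdec : WK t z - WK t (z - h) = Real.exp (-(t * r ^ 2)) • h +
      (Real.exp (-(t * r ^ 2)) - Real.exp (-(t * r' ^ 2))) • (z - h) := by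
    simp only [WK, neg_mul, r, r']
    module
  rw [hdec]
  refine (norm_add_le _ _).trans ?_
  rw [norm_smul, norm_smul, Real.norm_of_nonneg (Real.exp_pos _).le, Real.norm_eq_abs]
  change Real.exp (-(t * r ^ 2)) * η + |Real.exp (-(t * r ^ 2)) - Real.exp (-(t * r' ^ 2))| * r' ≤ _
  have h3 := aux_exp_sub (a := t * r ^ 2) (b := t * r' ^ 2)
  have h4 : |t * r ^ 2 - t * r' ^ 2| ≤ t * (η * (r + r')) := by
    have : t * r ^ 2 - t * r' ^ 2 = t * ((r - r') * (r + r')) := by ring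
    rw [this, abs_mul, abs_of_pos ht, abs_mul, abs_of_nonneg (by positivity : 0 ≤ r + r')]
    gcongr
    rw [abs_le]; constructor <;> linarith
  set E := Real.exp (-(t / 4) * r ^ 2) with hE
  have hE0 : 0 < E := Real.exp_pos _
  have hEE : E * E = Real.exp (-(t / 2) * r ^ 2) := by rw [hE, ← Real.exp_add]; ring_nf
  have h5 : Real.exp (-(t * r ^ 2)) ≤ E * E := by
    rw [hEE]; apply Real.exp_le_exp.2; nlinarith [mul_nonneg ht.le (sq_nonneg r)]
  have h6 : Real.exp (-(t * r' ^ 2)) ≤ 3 * (E * E) := by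
    have : Real.exp (-(t * r' ^ 2)) ≤ Real.exp 1 * (E * E) := by
      rw [hEE, ← Real.exp_add]; apply Real.exp_le_exp.2
      have : r ^ 2 ≤ 2 * r' ^ 2 + 2 * η ^ 2 := by nlinarith [sq_nonneg (r' - η)]
      nlinarith
    have h7 := Real.exp_one_lt_d9
    nlinarith [mul_pos hE0 hE0]
  have h8 : t * ((r + r') * r') * E ≤ 16 := by
    have ha : t * ((r + r') * r') ≤ 4 * (t * r ^ 2) + 3 := by
      have : (r + r') * r' ≤ (2 * r + η) * (r + η) := by nlinarith
      have : (r + r') * r' ≤ 4 * r ^ 2 + 3 * η ^ 2 := by nlinarith [sq_nonneg (2 * r - η), sq_nonneg (r - η), sq_nonneg (r - 3/4 * η)]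
      nlinarith
    have hb : E * Real.exp (t / 4 * r ^ 2) = 1 := by rw [hE, ← Real.exp_add]; simp
    have hc := Real.add_one_le_exp (t / 4 * r ^ 2)
    have hd : t * ((r + r') * r') ≤ 16 * Real.exp (t / 4 * r ^ 2) := by nlinarith
    nlinarith
  have hE1 : E ≤ 1 := by
    rw [hE, Real.exp_le_one_iff]; nlinarith [mul_nonneg ht.le (sq_nonneg r)]
  calc _ ≤ (E * E) * η + (t * (η * (r + r')) * (E * E + 3 * (E * E))) * r' := by
        gcongr
        refine h3.trans ?_
        gcongr
    _ = (E * η) * (E + 4 * (t * ((r + r') * r') * E)) := by ring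
    _ ≤ (E * η) * (1 + 4 * 16) := by gcongr
    _ = _ := by ring



lemma aux_split {F : ℝ → ℝ} (hF : IntegrableOn F (Set.Ioi 0)) {B η α : ℝ} (hη : 0 < η)
    (hα0 : 0 < α) (hα1 : α < 1)
    (h1 : ∀ t, 0 < t → t * η ^ 2 ≤ 1 → |F t| ≤ B * (η * t ^ (-(1 + α) / 2)))
    (h2 : ∀ t, 0 < t → 1 ≤ t * η ^ 2 → |F t| ≤ B * t ^ (-1 - α / 2)) :
    |∫ t in Set.Ioi (0 : ℝ), F t| ≤ B * (2 / (1 - α) + 2 / α) * η ^ α := by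
  set T : ℝ := η ^ (-2 : ℝ) with hT
  have hT0 : 0 < T := Real.rpow_pos_of_pos hη _
  have hTη : T * η ^ 2 = 1 := by
    rw [hT, ← Real.rpow_natCast η 2, ← Real.rpow_add hη]; norm_num
  have hU : Set.Ioi (0 : ℝ) = Set.Ioc 0 T ∪ Set.Ioi T := (Set.Ioc_union_Ioi_eq_Ioi hT0.le).symm
  have hA : IntegrableOn F (Set.Ioc 0 T) := hF.mono_set (by rw [hU]; exact Set.subset_union_left)
  have hB : IntegrableOn F (Set.Ioi T) := hF.mono_set (by rw [hU]; exact Set.subset_union_right)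
  have e1 : |∫ t in Set.Ioc 0 T, F t| ≤ B * (2 / (1 - α) * η ^ α) := by
    have hi : IntegrableOn (fun t : ℝ => t ^ (-(1 + α) / 2)) (Set.Ioc 0 T) :=
      (intervalIntegrable_iff_integrableOn_Ioc_of_le hT0.le).1
        (intervalIntegral.intervalIntegrable_rpow' (by linarith))
    have hb : ∀ᵐ t ∂(volume.restrict (Set.Ioc 0 T)), ‖F t‖ ≤ B * (η * t ^ (-(1 + α) / 2)) := by
      filter_upwards [ae_restrict_mem measurableSet_Ioc] with t ht
      refine h1 t ht.1 ?_
      rw [← hTη]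
      exact mul_le_mul_of_nonneg_right ht.2 (by positivity)
    refine (norm_integral_le_of_norm_le ((hi.const_mul η).const_mul B) hb).trans (le_of_eq ?_)
    rw [integral_const_mul, integral_const_mul, ← intervalIntegral.integral_of_le hT0.le,
      integral_rpow (Or.inl (by linarith)), Real.zero_rpow (by linarith)]
    have h3 : T ^ (-(1 + α) / 2 + 1) * η = η ^ α := by
      rw [hT, ← Real.rpow_mul hη.le]
      nth_rewrite 2 [← Real.rpow_one η]
      rw [← Real.rpow_add hη]
      congr 1; ring
    rw [← h3]
    have : 1 - α ≠ 0 := by linarith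
    have : -(1 + α) / 2 + 1 = (1 - α) / 2 := by ring
    rw [this]
    field_simp
    ring
  have e2 : |∫ t in Set.Ioi T, F t| ≤ B * (2 / α * η ^ α) := by
    have hi : IntegrableOn (fun t : ℝ => t ^ (-1 - α / 2)) (Set.Ioi T) :=
      integrableOn_Ioi_rpow_of_lt (by linarith) hT0
    have hb : ∀ᵐ t ∂(volume.restrict (Set.Ioi T)), ‖F t‖ ≤ B * t ^ (-1 - α / 2) := by
      filter_upwards [ae_restrict_mem measurableSet_Ioi] with t ht
      have ht : T < t := ht
      refine h2 t (hT0.trans ht) ?_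
      rw [← hTη]
      exact mul_le_mul_of_nonneg_right ht.le (by positivity)
    refine (norm_integral_le_of_norm_le (hi.const_mul B) hb).trans (le_of_eq ?_)
    rw [integral_const_mul, integral_Ioi_rpow_of_lt (by linarith) hT0]
    have h3 : T ^ (-1 - α / 2 + 1) = η ^ α := by
      rw [hT, ← Real.rpow_mul hη.le]
      congr 1; ring
    rw [h3]
    have : -1 - α / 2 + 1 = - (α / 2) := by ring
    rw [this]
    field_simp
  rw [hU, setIntegral_union (by
    rw [Set.disjoint_left]; intro t ht ht'; exact absurd ht.2 (not_le.2 ht')) measurableSet_Ioi hA hB]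
  calc _ ≤ _ := abs_add_le _ _
    _ ≤ _ := add_le_add e1 e2
    _ = _ := by ring

lemma aux_morrey {n : ℕ} (hn : 1 ≤ n) {s p : ℝ} (hs0 : 0 < s) (hs1 : s < 1)
    (hp : 1 < p) (hsp : (n : ℝ) < s * p) :
    ∃ C : ℝ, 0 ≤ C ∧ ∀ u : EuclideanSpace ℝ (Fin n) → ℝ, ContDiff ℝ (⊤ : ℕ∞) u → HasCompactSupport u →
      eLpNorm (rieszGrad n s u) (ENNReal.ofReal p) volume < ⊤ → ∀ x x',
      |u x - u x'| ≤ C * (eLpNorm (rieszGrad n s u) (ENNReal.ofReal p) volume).toReal * ‖x - x'‖ ^ (s - n / p) := by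
  have hp0 : 0 < p := by linarith
  have hn1 : (1 : ℝ) ≤ n := by exact_mod_cast hn
  set α : ℝ := s - n / p with hα
  have hα0 : 0 < α := by
    have : (n : ℝ) / p < s := (div_lt_iff₀ hp0).2 hsp
    linarith
  have hα1 : α < 1 := by
    have : 0 < (n : ℝ) / p := by positivity
    linarith
  set q := p.conjExponent with hq
  have hpq : p.HolderConjugate q := Real.HolderConjugate.conjExponent hp
  have hq0 : 0 < q := hpq.symm.pos
  have hqi : 1 / q = 1 - 1 / p := by
    have := hpq.inv_add_inv_eq_one
    rw [one_div, one_div]; linarith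
  set K : ℝ := (4 * Real.pi / q) ^ ((n : ℝ) / 2 * (1 / q)) with hK
  have hpi := Real.pi_pos
  have hK0 : 0 ≤ K := by positivity
  have hcR := cR_pos n hn hs0 hs1
  have h1α : 0 < 1 - α := by linarith
  refine ⟨65 * K * (2 / (1 - α) + 2 / α) / cR n s, by positivity, ?_⟩
  intro u hu hus hlt x x'
  obtain ⟨V, hV⟩ := aux_goodPair hu hus
  have hg : MemLp (rieszGrad n s u) (ENNReal.ofReal p) :=
    ⟨(aux_grad_meas hu.continuous).aestronglyMeasurable, hlt⟩
  set N := (eLpNorm (rieszGrad n s u) (ENNReal.ofReal p) volume).toReal with hN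
  have hN0 : 0 ≤ N := ENNReal.toReal_nonneg
  rcases eq_or_ne x x' with rfl | hne
  · simp [Real.zero_rpow hα0.ne']
  have hη : 0 < ‖x - x'‖ := norm_pos_iff.2 (sub_ne_zero.2 hne)
  set η := ‖x - x'‖ with hηd
  obtain ⟨i1, e1⟩ := hV.repr hn hs0 hs1 x
  obtain ⟨i2, e2⟩ := hV.repr hn hs0 hs1 x'
  have hWc : ∀ (t : ℝ) (z : EuclideanSpace ℝ (Fin n)), Continuous fun y => WK t (z - y) := by
    intro t z; unfold WK; fun_prop
  have hP : ∀ t : ℝ, 0 < t → t ^ (((n : ℝ) - s - 1) / 2) * (Real.pi / (t / 4 * q)) ^ ((n : ℝ) / 2 * (1 / q))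
      = K * t ^ (-(1 + α) / 2) := by
    intro t ht
    have : Real.pi / (t / 4 * q) = (4 * Real.pi / q) * t⁻¹ := by field_simp
    rw [this, Real.mul_rpow (by positivity) (by positivity), Real.inv_rpow ht.le, ← Real.rpow_neg ht.le,
      mul_left_comm, ← Real.rpow_add ht]
    congr 2
    rw [hα, hqi]; ring
  have cb := fun (t : ℝ) (ht : 0 < t) (z : EuclideanSpace ℝ (Fin n)) =>
    aux_conv_bound hpq hg (hWc t z) (show 0 < t / 4 by positivity) z (fun y => aux_WK_bound ht (z - y))
  have hIntg := aux_split (i1.sub i2) (B := 65 * K * N) hη hα0 hα1 ?_ ?_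
  · have : ∫ t in Set.Ioi (0 : ℝ), ((fun t : ℝ => t ^ (((n : ℝ) - s - 1) / 2) *
      ∫ y, inner ℝ (WK t (x - y)) (rieszGrad n s u y)) - (fun t : ℝ => t ^ (((n : ℝ) - s - 1) / 2) *
      ∫ y, inner ℝ (WK t (x' - y)) (rieszGrad n s u y))) t = cR n s * (u x - u x') := by
      rw [integral_sub' i1 i2, e1, e2]; ring
    rw [this, abs_mul, abs_of_pos hcR] at hIntg
    rw [div_mul_eq_mul_div, div_mul_eq_mul_div, le_div_iff₀ hcR]
    linarith
  · intro t ht htη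
    have hb := aux_conv_bound hpq hg (κ := fun y => WK t (x - y) - WK t (x' - y)) ((hWc t x).sub (hWc t x')) (show 0 < t / 4 by positivity) x
      (A := 65 * η) (fun y => by
        have := aux_WK_diff ht (x - y) (x - x') htη
        rwa [show x - y - (x - x') = x' - y by abel] at this)
    have e3 : ∫ y, inner ℝ (WK t (x - y) - WK t (x' - y)) (rieszGrad n s u y) =
        (∫ y, inner ℝ (WK t (x - y)) (rieszGrad n s u y)) - ∫ y, inner ℝ (WK t (x' - y)) (rieszGrad n s u y) := by
      simp_rw [inner_sub_left]
      exact integral_sub (cb t ht x).1 (cb t ht x').1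
    have hb2 := hb.2
    rw [e3] at hb2
    simp only [Pi.sub_apply]
    rw [← mul_sub, abs_mul, abs_of_pos (Real.rpow_pos_of_pos ht _)]
    calc _ ≤ t ^ (((n : ℝ) - s - 1) / 2) * (65 * η * (N * (Real.pi / (t / 4 * q)) ^ ((n : ℝ) / 2 * (1 / q)))) := by gcongr
      _ = 65 * η * N * (t ^ (((n : ℝ) - s - 1) / 2) * (Real.pi / (t / 4 * q)) ^ ((n : ℝ) / 2 * (1 / q))) := by ring
      _ = _ := by rw [hP t ht]; ring
  · intro t ht htη
    have b1 := (cb t ht x).2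
    have b2 := (cb t ht x').2
    simp only [Pi.sub_apply]
    rw [← mul_sub, abs_mul, abs_of_pos (Real.rpow_pos_of_pos ht _)]
    have h3 : t ^ (-1 - α / 2) = t ^ (-(1 / 2) : ℝ) * t ^ (-(1 + α) / 2) := by
      rw [← Real.rpow_add ht]; congr 1; ring
    have h4 : 0 ≤ t ^ (-(1 / 2) : ℝ) * N * (K * t ^ (-(1 + α) / 2)) := by positivity
    calc _ ≤ t ^ (((n : ℝ) - s - 1) / 2) * (2 * (t ^ (-(1 / 2) : ℝ) * (N * (Real.pi / (t / 4 * q)) ^ ((n : ℝ) / 2 * (1 / q))))) := by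
            gcongr
            refine (abs_sub _ _).trans ?_
            rw [two_mul]
            exact add_le_add b1 b2
      _ = 2 * t ^ (-(1 / 2) : ℝ) * N * (t ^ (((n : ℝ) - s - 1) / 2) * (Real.pi / (t / 4 * q)) ^ ((n : ℝ) / 2 * (1 / q))) := by ring
      _ ≤ _ := by rw [hP t ht, h3]; linarith


lemma aux_sup {n : ℕ} {p : ℝ} (hp : 0 < p) {u : EuclideanSpace ℝ (Fin n) → ℝ} (hu : Continuous u)
    {M : ℝ≥0∞} (hM : eLpNorm u (ENNReal.ofReal p) volume ≤ M) {C0 : ℝ}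
    (hC : ∀ x y, ‖x - y‖ ≤ 1 → |u x - u y| ≤ C0) (x : EuclideanSpace ℝ (Fin n)) :
    ENNReal.ofReal (|u x| - C0) ≤
      (M ^ p / volume (Metric.ball (0 : EuclideanSpace ℝ (Fin n)) 1)) ^ (1 / p) := by
  have h := mul_meas_ge_le_pow_eLpNorm' volume (p := ENNReal.ofReal p) (by simpa using hp) ENNReal.ofReal_ne_top
    hu.aestronglyMeasurable (ENNReal.ofReal (|u x| - C0))
  rw [ENNReal.toReal_ofReal hp.le] at h
  have hsub : Metric.ball x 1 ⊆ {y | ENNReal.ofReal (|u x| - C0) ≤ ‖u y‖ₑ} := by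
    intro y hy
    rw [Metric.mem_ball, dist_comm, dist_eq_norm] at hy
    have h1 := hC x y hy.le
    have h2 := abs_sub_abs_le_abs_sub (u x) (u y)
    rw [Set.mem_setOf_eq, ← ofReal_norm, Real.norm_eq_abs]
    exact ENNReal.ofReal_le_ofReal (by linarith)
  have hv : volume (Metric.ball x 1) = volume (Metric.ball (0 : EuclideanSpace ℝ (Fin n)) 1) :=
    Measure.addHaar_ball_center _ _ _
  rw [one_div, ENNReal.le_rpow_inv_iff hp]
  rw [ENNReal.le_div_iff_mul_le (Or.inl (Metric.measure_ball_pos _ _ one_pos).ne') (Or.inl measure_ball_lt_top.ne), ← hv]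
  calc _ ≤ _ := mul_le_mul_right (measure_mono hsub) _
    _ ≤ _ := h
    _ ≤ _ := by gcongr

lemma aux_compact {n : ℕ} {K : Set (EuclideanSpace ℝ (Fin n))} (hK : IsCompact K) {α μ L B : ℝ}
    (hμ : 0 < μ) (hμα : μ < α) (hL : 0 ≤ L) {u : ℕ → EuclideanSpace ℝ (Fin n) → ℝ}
    (huc : ∀ k, Continuous (u k)) (hB : ∀ k x, |u k x| ≤ B)
    (hH : ∀ k x y, |u k x - u k y| ≤ L * ‖x - y‖ ^ α) :
    ∃ (φ : ℕ → ℕ) (f : EuclideanSpace ℝ (Fin n) → ℝ), StrictMono φ ∧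
      Tendsto (fun j => holderNorm n μ K (fun x => u (φ j) x - f x)) atTop (nhds 0) := by
  have hα : 0 < α := hμ.trans hμα
  haveI : CompactSpace K := isCompact_iff_compactSpace.1 hK
  let F : ℕ → BoundedContinuousFunction K ℝ := fun k =>
    BoundedContinuousFunction.mkOfCompact ⟨fun x : K => u k x, (huc k).comp continuous_subtype_val⟩
  have hFa : ∀ k (x : K), F k x = u k x := fun k x => rfl
  have hcpt : IsCompact (closure (Set.range F)) := by
    refine BoundedContinuousFunction.arzela_ascoli (Set.Icc (-B) B) isCompact_Icc _ ?_ ?_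
    · rintro _ x ⟨k, rfl⟩
      exact abs_le.1 (hB k x)
    · refine Metric.equicontinuous_of_continuity_modulus (fun r => L * r ^ α) ?_ _ ?_
      · have : ContinuousAt (fun r : ℝ => L * r ^ α) 0 :=
          continuousAt_const.mul (Real.continuousAt_rpow_const _ _ (Or.inr hα.le))
        have h2 := this.tendsto
        simpa [Real.zero_rpow hα.ne'] using h2
      · rintro x y ⟨_, k, rfl⟩
        have := hH k x y
        rw [Real.dist_eq, Subtype.dist_eq, dist_eq_norm]
        exact this
  obtain ⟨g, -, φ, hφ, hlim⟩ := hcpt.tendsto_subseq (x := F) (fun k => subset_closure ⟨k, rfl⟩)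
  classical
  let f : EuclideanSpace ℝ (Fin n) → ℝ := fun x => if h : x ∈ K then g ⟨x, h⟩ else 0
  have hf : ∀ x (h : x ∈ K), f x = g ⟨x, h⟩ := fun x h => dif_pos h
  set δ : ℕ → ℝ := fun j => dist (F (φ j)) g with hδ
  have hδ0 : Tendsto δ atTop (nhds 0) := tendsto_iff_dist_tendsto_zero.1 hlim
  have hδn : ∀ j, 0 ≤ δ j := fun j => dist_nonneg
  have h1 : ∀ j, ∀ x ∈ K, |u (φ j) x - f x| ≤ δ j := by
    intro j x hx
    rw [hf x hx, ← Real.dist_eq]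
    exact BoundedContinuousFunction.dist_coe_le_dist (f := F (φ j)) (g := g) ⟨x, hx⟩
  have hpt : ∀ x ∈ K, Tendsto (fun j => u (φ j) x) atTop (nhds (f x)) := by
    intro x hx
    rw [tendsto_iff_dist_tendsto_zero]
    exact squeeze_zero (fun j => dist_nonneg) (fun j => by rw [Real.dist_eq]; exact h1 j x hx) hδ0
  have hfH : ∀ x ∈ K, ∀ y ∈ K, |f x - f y| ≤ L * ‖x - y‖ ^ α := by
    intro x hx y hy
    exact le_of_tendsto ((hpt x hx).sub (hpt y hy)).abs (Eventually.of_forall fun j => hH _ x y)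
  set θ := μ / α with hθ
  have hθ0 : 0 < θ := by positivity
  have hθ1 : θ < 1 := (div_lt_one hα).2 hμα
  have h2 : ∀ j, ∀ x ∈ K, ∀ y ∈ K, x ≠ y →
      |(u (φ j) x - f x) - (u (φ j) y - f y)| / ‖x - y‖ ^ μ ≤ (2 * L) ^ θ * (2 * δ j) ^ (1 - θ) := by
    intro j x hx y hy hxy
    have hη : 0 < ‖x - y‖ := norm_pos_iff.2 (sub_ne_zero.2 hxy)
    rw [div_le_iff₀ (Real.rpow_pos_of_pos hη _)]
    set w := |(u (φ j) x - f x) - (u (φ j) y - f y)| with hw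
    have hw0 : 0 ≤ w := abs_nonneg _
    have b1 : w ≤ 2 * δ j := by
      have a1 := h1 j x hx
      have a2 := h1 j y hy
      have := abs_sub (u (φ j) x - f x) (u (φ j) y - f y)
      linarith
    have b2 : w ≤ 2 * L * ‖x - y‖ ^ α := by
      have a1 := hH (φ j) x y
      have a2 := hfH x hx y hy
      have := abs_sub (u (φ j) x - u (φ j) y) (f x - f y)
      rw [hw, show (u (φ j) x - f x) - (u (φ j) y - f y) = (u (φ j) x - u (φ j) y) - (f x - f y) by ring]
      linarith
    have hdec : w = w ^ θ * w ^ (1 - θ) := by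
      rcases hw0.eq_or_lt with h | h
      · rw [← h, Real.zero_rpow hθ0.ne', zero_mul]
      · rw [← Real.rpow_add h, add_sub_cancel, Real.rpow_one]
    calc w = w ^ θ * w ^ (1 - θ) := hdec
      _ ≤ (2 * L * ‖x - y‖ ^ α) ^ θ * (2 * δ j) ^ (1 - θ) := by
          have : 0 ≤ 1 - θ := by linarith
          gcongr
      _ = _ := by
          rw [Real.mul_rpow (by positivity) (by positivity), ← Real.rpow_mul hη.le,
            show α * θ = μ by rw [hθ]; field_simp]
          ring
  refine ⟨φ, f, hφ, ?_⟩
  have hup : Tendsto (fun j => ENNReal.ofReal (δ j) + ENNReal.ofReal ((2 * L) ^ θ * (2 * δ j) ^ (1 - θ))) atTop (nhds 0) := by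
    have c1 : Tendsto (fun j => ENNReal.ofReal (δ j)) atTop (nhds 0) := by
      have := ENNReal.tendsto_ofReal hδ0
      simpa using this
    have c2 : Tendsto (fun j => (2 * L) ^ θ * (2 * δ j) ^ (1 - θ)) atTop (nhds 0) := by
      have d1 : Tendsto (fun j => 2 * δ j) atTop (nhds 0) := by simpa using hδ0.const_mul 2
      have d2 := d1.rpow_const (p := 1 - θ) (Or.inr (by linarith))
      rw [Real.zero_rpow (by linarith)] at d2
      simpa using d2.const_mul ((2 * L) ^ θ)
    have c3 := ENNReal.tendsto_ofReal c2
    rw [ENNReal.ofReal_zero] at c3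
    simpa using c1.add c3
  refine tendsto_of_tendsto_of_tendsto_of_le_of_le tendsto_const_nhds hup (fun j => zero_le) (fun j => ?_)
  unfold holderNorm
  refine add_le_add ?_ ?_
  · exact iSup₂_le fun x hx => ENNReal.ofReal_le_ofReal (h1 j x hx)
  · exact iSup₂_le fun x hx => iSup₂_le fun y hy => iSup_le fun hxy => ENNReal.ofReal_le_ofReal (h2 j x hx y hy hxy)


/-- Compact embedding `H^{s,p}(ℝⁿ) ↪↪ C^{0,μ}(Ω̄)`, supercritical case `sp > n`,
`0 < μ < μ_s^* = s - n/p`. -/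
theorem bessel_compact_embedding_supercritical
    (n : ℕ) (hn : 1 ≤ n) (s p : ℝ) (hs0 : 0 < s) (hs1 : s < 1)
    (hp : 1 ≤ p) (hsp : (n : ℝ) < s * p)
    (Ω : Set (EuclideanSpace ℝ (Fin n))) (hΩopen : IsOpen Ω)
    (hΩbdd : Bornology.IsBounded Ω)
    (μ : ℝ) (hμ0 : 0 < μ) (hμ : μ < s - n / p)
    (u : ℕ → EuclideanSpace ℝ (Fin n) → ℝ)
    (husmooth : ∀ k, ContDiff ℝ (⊤ : ℕ∞) (u k))
    (husupp : ∀ k, HasCompactSupport (u k))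
    (hbdd : (⨆ k, eLpNorm (u k) (ENNReal.ofReal p) volume
        + eLpNorm (rieszGrad n s (u k)) (ENNReal.ofReal p) volume) < ⊤) :
    ∃ (φ : ℕ → ℕ) (f : EuclideanSpace ℝ (Fin n) → ℝ), StrictMono φ ∧
      Tendsto (fun j => holderNorm n μ (closure Ω) (fun x => u (φ j) x - f x))
        atTop (nhds 0) := by
  have hn1 : (1 : ℝ) ≤ n := by exact_mod_cast hn
  have hp1 : 1 < p := by
    by_contra hc
    have : p = 1 := le_antisymm (not_lt.1 hc) hp
    rw [this] at hsp
    linarith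
  have hp0 : 0 < p := by linarith
  obtain ⟨C, hC0, hC⟩ := aux_morrey hn hs0 hs1 hp1 hsp
  set M : ℝ≥0∞ := ⨆ k, eLpNorm (u k) (ENNReal.ofReal p) volume
        + eLpNorm (rieszGrad n s (u k)) (ENNReal.ofReal p) volume with hM
  have hMk : ∀ k, eLpNorm (u k) (ENNReal.ofReal p) volume
        + eLpNorm (rieszGrad n s (u k)) (ENNReal.ofReal p) volume ≤ M := fun k =>
    le_iSup (fun k => eLpNorm (u k) (ENNReal.ofReal p) volume
        + eLpNorm (rieszGrad n s (u k)) (ENNReal.ofReal p) volume) k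
  have hM1 : ∀ k, eLpNorm (u k) (ENNReal.ofReal p) volume ≤ M := fun k => le_self_add.trans (hMk k)
  have hM2 : ∀ k, eLpNorm (rieszGrad n s (u k)) (ENNReal.ofReal p) volume ≤ M := fun k =>
    le_add_self.trans (hMk k)
  have hL : 0 ≤ C * M.toReal := mul_nonneg hC0 ENNReal.toReal_nonneg
  have hH : ∀ k x y, |u k x - u k y| ≤ C * M.toReal * ‖x - y‖ ^ (s - n / p) := by
    intro k x y
    refine (hC (u k) (husmooth k) (husupp k) ((hM2 k).trans_lt hbdd) x y).trans ?_
    have := ENNReal.toReal_mono hbdd.ne (hM2 k)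
    gcongr
  have hα0 : 0 < s - n / p := hμ0.trans hμ
  have hV : (M ^ p / volume (Metric.ball (0 : EuclideanSpace ℝ (Fin n)) 1)) ^ (1 / p) ≠ ⊤ := by
    refine ENNReal.rpow_ne_top_of_nonneg (by positivity) ?_
    exact ENNReal.div_ne_top (ENNReal.rpow_ne_top_of_nonneg hp0.le hbdd.ne) (Metric.measure_ball_pos _ _ one_pos).ne'
  refine aux_compact (B := C * M.toReal +
    ((M ^ p / volume (Metric.ball (0 : EuclideanSpace ℝ (Fin n)) 1)) ^ (1 / p)).toReal)
    hΩbdd.isCompact_closure hμ0 hμ hL (fun k => (husmooth k).continuous) (fun k x => ?_) hH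
  have h1 := aux_sup hp0 (husmooth k).continuous (hM1 k) (C0 := C * M.toReal) (fun x y hxy => by
    refine (hH k x y).trans ?_
    have := Real.rpow_le_one (norm_nonneg _) hxy hα0.le
    exact mul_le_of_le_one_right hL this) x
  have h2 := (ENNReal.ofReal_le_iff_le_toReal hV).1 h1
  linarith

end
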